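/- Let F be a field, q, q' ∈ F with q ≠ 0, and f, g, f', g' ∈ F[h] with deg f > 1. Then H_q(f,g) is isomorphic as an F-algebra to H_{q'}(f',g') if and only if q = q' and the pair (f',g') can be obtained from (f,g) by a composition of the transformations (f,g) ↦ (f(h−α)+α, g(h−α)) for α ∈ F, (f,g) ↦ (λ f(λ^{-1}h), g(λ^{-1}h)) for λ ∈ F*, and (f,g) ↦ (f, λμ g) for λ, μ ∈ F*. In particular, if H_q(f,g) ≅ H_{q'}(f',g') then q = q', deg f = deg f' and deg g = deg g'. -/

import Mathlib

open Polynomial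

/-- The three generators `x`, `y`, `h` of a quantum generalized Heisenberg algebra. -/
inductive QGHAGen : Type
  | x : QGHAGen
  | y : QGHAGen
  | h : QGHAGen

/-- The defining relations of the quantum generalized Heisenberg algebra `H_q(f,g)`:
`h*x = x*f(h)`, `y*h = f(h)*y`, and `y*x - q*(x*y) = g(h)`. -/
inductive QGHARel (F : Type*) [Field F] (q : F) (f g : F[X]) :
    FreeAlgebra F QGHAGen → FreeAlgebra F QGHAGen → Prop
  | hx : QGHARel F q f g
      (FreeAlgebra.ι F QGHAGen.h * FreeAlgebra.ι F QGHAGen.x)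
      (FreeAlgebra.ι F QGHAGen.x * aeval (FreeAlgebra.ι F QGHAGen.h) f)
  | yh : QGHARel F q f g
      (FreeAlgebra.ι F QGHAGen.y * FreeAlgebra.ι F QGHAGen.h)
      (aeval (FreeAlgebra.ι F QGHAGen.h) f * FreeAlgebra.ι F QGHAGen.y)
  | yx : QGHARel F q f g
      (FreeAlgebra.ι F QGHAGen.y * FreeAlgebra.ι F QGHAGen.x)
      (q • (FreeAlgebra.ι F QGHAGen.x * FreeAlgebra.ι F QGHAGen.y)
        + aeval (FreeAlgebra.ι F QGHAGen.h) g)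

/-- The quantum generalized Heisenberg algebra `H_q(f,g)`. -/
def QGHA (F : Type*) [Field F] (q : F) (f g : F[X]) : Type _ :=
  RingQuot (QGHARel F q f g)

namespace QGHA

variable {F : Type*} [Field F] (q : F) (f g : F[X])

instance : Ring (QGHA F q f g) :=
  inferInstanceAs (Ring (RingQuot (QGHARel F q f g)))

instance : Algebra F (QGHA F q f g) :=
  inferInstanceAs (Algebra F (RingQuot (QGHARel F q f g)))

/-- The generator `x` of `H_q(f,g)`. -/
def x : QGHA F q f g :=
  RingQuot.mkAlgHom F (QGHARel F q f g) (FreeAlgebra.ι F QGHAGen.x)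

/-- The generator `y` of `H_q(f,g)`. -/
def y : QGHA F q f g :=
  RingQuot.mkAlgHom F (QGHARel F q f g) (FreeAlgebra.ι F QGHAGen.y)

/-- The generator `h` of `H_q(f,g)`. -/
def h : QGHA F q f g :=
  RingQuot.mkAlgHom F (QGHARel F q f g) (FreeAlgebra.ι F QGHAGen.h)

end QGHA

/-- One elementary transformation on the pair of parameters `(f,g)` of a quantum
generalized Heisenberg algebra: type I is `(f,g) ↦ (f(h−α)+α, g(h−α))` for `α ∈ F`;
type II is `(f,g) ↦ (λ f(λ⁻¹h), g(λ⁻¹h))` for `λ ∈ F*`; type III is `(f,g) ↦ (f, λμ·g)`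
for `λ, μ ∈ F*`. -/
inductive QGHAStep (F : Type*) [Field F] : F[X] × F[X] → F[X] × F[X] → Prop
  | typeI (f g : F[X]) (α : F) :
      QGHAStep F (f, g) (f.comp (X - C α) + C α, g.comp (X - C α))
  | typeII (f g : F[X]) (lam : F) (hlam : lam ≠ 0) :
      QGHAStep F (f, g) (C lam * f.comp (C lam⁻¹ * X), g.comp (C lam⁻¹ * X))
  | typeIII (f g : F[X]) (lam mu : F) (hlam : lam ≠ 0) (hmu : mu ≠ 0) :
      QGHAStep F (f, g) (f, (lam * mu) • g)


noncomputable section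

namespace QGHA

variable {F : Type*} [Field F] {q : F} {f g : F[X]}

variable (q f g) in
/-- The canonical projection from the free algebra. -/
def mk : FreeAlgebra F QGHAGen →ₐ[F] QGHA F q f g :=
  RingQuot.mkAlgHom F (QGHARel F q f g)

theorem mk_surjective : Function.Surjective (mk q f g) :=
  RingQuot.mkAlgHom_surjective F (QGHARel F q f g)

theorem mk_rel {a b : FreeAlgebra F QGHAGen} (hab : QGHARel F q f g a b) :
    mk q f g a = mk q f g b :=
  RingQuot.mkAlgHom_rel F hab

theorem mk_ι_x : mk q f g (FreeAlgebra.ι F QGHAGen.x) = x q f g := rfl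
theorem mk_ι_y : mk q f g (FreeAlgebra.ι F QGHAGen.y) = y q f g := rfl
theorem mk_ι_h : mk q f g (FreeAlgebra.ι F QGHAGen.h) = h q f g := rfl

theorem h_mul_x : h q f g * x q f g = x q f g * aeval (h q f g) f := by
  simpa [← aeval_algHom_apply, mk_ι_x, mk_ι_h] using mk_rel (QGHARel.hx (q := q) (f := f) (g := g))

theorem y_mul_h : y q f g * h q f g = aeval (h q f g) f * y q f g := by
  simpa [← aeval_algHom_apply, mk_ι_y, mk_ι_h] using mk_rel (QGHARel.yh (q := q) (f := f) (g := g))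

theorem y_mul_x :
    y q f g * x q f g = q • (x q f g * y q f g) + aeval (h q f g) g := by
  simpa [← aeval_algHom_apply, mk_ι_x, mk_ι_y, mk_ι_h] using
    mk_rel (QGHARel.yx (q := q) (f := f) (g := g))

@[elab_as_elim]
theorem induction {P : QGHA F q f g → Prop} (algebraMap : ∀ r, P (algebraMap F _ r))
    (x : P (x q f g)) (y : P (y q f g)) (h : P (h q f g))
    (mul : ∀ a b, P a → P b → P (a * b)) (add : ∀ a b, P a → P b → P (a + b))
    (a : QGHA F q f g) : P a := by
  obtain ⟨a, rfl⟩ := mk_surjective a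
  induction a using FreeAlgebra.induction with
  | grade0 r => simpa using algebraMap r
  | grade1 i =>
    cases i
    exacts [x, y, h]
  | mul a b ha hb => rw [map_mul]; exact mul _ _ ha hb
  | add a b ha hb => rw [map_add]; exact add _ _ ha hb

section lift

variable {B : Type*} [Ring B] [Algebra F B]

/-- The universal property of `H_q(f,g)`. -/
def lift (x' y' h' : B) (hx : h' * x' = x' * aeval h' f) (yh : y' * h' = aeval h' f * y')
    (yx : y' * x' = q • (x' * y') + aeval h' g) : QGHA F q f g →ₐ[F] B :=
  RingQuot.liftAlgHom F ⟨FreeAlgebra.lift F (fun i : QGHAGen => i.casesOn x' y' h'), by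
    intro a b hab
    cases hab <;> simpa [← aeval_algHom_apply]⟩

variable {x' y' h' : B} {hx : h' * x' = x' * aeval h' f} {yh : y' * h' = aeval h' f * y'}
  {yx : y' * x' = q • (x' * y') + aeval h' g}

@[simp]
theorem lift_x : lift x' y' h' hx yh yx (x q f g) = x' :=
  (RingQuot.liftAlgHom_mkAlgHom_apply _ _ _ _).trans (FreeAlgebra.lift_ι_apply _ _)

@[simp]
theorem lift_y : lift x' y' h' hx yh yx (y q f g) = y' :=
  (RingQuot.liftAlgHom_mkAlgHom_apply _ _ _ _).trans (FreeAlgebra.lift_ι_apply _ _)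

@[simp]
theorem lift_h : lift x' y' h' hx yh yx (h q f g) = h' :=
  (RingQuot.liftAlgHom_mkAlgHom_apply _ _ _ _).trans (FreeAlgebra.lift_ι_apply _ _)

theorem algHom_ext {φ ψ : QGHA F q f g →ₐ[F] B} (hx : φ (x q f g) = ψ (x q f g))
    (hy : φ (y q f g) = ψ (y q f g)) (hh : φ (h q f g) = ψ (h q f g)) : φ = ψ := by
  ext a
  induction a using QGHA.induction with
  | algebraMap r => simp
  | x => exact hx
  | y => exact hy
  | h => exact hh
  | mul a b ha hb => simp [ha, hb]
  | add a b ha hb => simp [ha, hb]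

end lift

/-! ### The PBW basis -/

variable (f) in
/-- Substitution of `f`, as an endomorphism of `F[X]`. -/
def subst : F[X] →ₐ[F] F[X] := aeval f

theorem subst_apply (p : F[X]) : subst f p = p.comp f := by
  simp [subst, comp, aeval_def, algebraMap_eq]

theorem subst_X : subst f X = f := by simp [subst]

theorem subst_pow_succ_apply (n : ℕ) (p : F[X]) :
    (subst f ^ (n + 1)) p = (subst f ^ n) (subst f p) := by
  rw [pow_succ, AlgHom.mul_apply]

theorem subst_pow_succ_apply' (n : ℕ) (p : F[X]) :
    (subst f ^ (n + 1)) p = subst f ((subst f ^ n) p) := by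
  rw [pow_succ', AlgHom.mul_apply]

variable (q f g) in
/-- The polynomials with `y * x ^ n = q ^ n • x ^ n * y + x ^ (n - 1) * correction n`. -/
def correction : ℕ → F[X]
  | 0 => 0
  | n + 1 => q • correction n + (subst f ^ n) g

theorem correction_succ (n : ℕ) :
    correction q f g (n + 1) = q • correction q f g n + (subst f ^ n) g := rfl

variable (F) in
/-- The space of coefficient families with respect to the PBW basis: the coefficient at `(i, k)`
is the polynomial in `h` standing between `x ^ i` and `y ^ k`. -/
abbrev Coeffs : Type _ := ℕ × ℕ →₀ F[X]

variable (F) in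
/-- Left multiplication by `x` on PBW coefficients. -/
def xEnd : Module.End F (Coeffs F) :=
  Finsupp.lsum F fun s => Finsupp.lsingle (s.1 + 1, s.2)

variable (q f g) in
/-- Left multiplication by `y` on PBW coefficients. -/
def yEnd : Module.End F (Coeffs F) :=
  Finsupp.lsum F fun s =>
    Finsupp.lsingle (s.1, s.2 + 1) ∘ₗ (q ^ s.1 • (subst f).toLinearMap) +
      Finsupp.lsingle (s.1 - 1, s.2) ∘ₗ LinearMap.mulLeft F (correction q f g s.1)

variable (f) in
/-- Left multiplication by `p(h)` on PBW coefficients. -/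
def hEnd (p : F[X]) : Module.End F (Coeffs F) :=
  Finsupp.lsum F fun s => Finsupp.lsingle s ∘ₗ LinearMap.mulLeft F ((subst f ^ s.1) p)

@[simp]
theorem xEnd_single (s : ℕ × ℕ) (c : F[X]) :
    xEnd F (Finsupp.single s c) = Finsupp.single (s.1 + 1, s.2) c := by
  simp [xEnd]

@[simp]
theorem yEnd_single (s : ℕ × ℕ) (c : F[X]) :
    yEnd q f g (Finsupp.single s c) = Finsupp.single (s.1, s.2 + 1) (q ^ s.1 • subst f c) +
      Finsupp.single (s.1 - 1, s.2) (correction q f g s.1 * c) := by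
  simp [yEnd]

@[simp]
theorem hEnd_single (p : F[X]) (s : ℕ × ℕ) (c : F[X]) :
    hEnd f p (Finsupp.single s c) = Finsupp.single s ((subst f ^ s.1) p * c) := by
  simp [hEnd]

theorem aeval_hEnd (p : F[X]) : aeval (hEnd f X) p = hEnd f p := by
  induction p using Polynomial.induction_on' with
  | add p r hp hr => ext; simp_all [add_mul]
  | monomial n r =>
    rw [aeval_monomial]
    induction n with
    | zero =>
      refine Finsupp.lhom_ext fun s c => ?_
      rw [monomial_zero_left, ← algebraMap_eq, hEnd_single, AlgHom.commutes, pow_zero, mul_one,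
        Module.algebraMap_end_apply, Finsupp.smul_single, Algebra.smul_def]
    | succ n ih =>
      rw [pow_succ, ← mul_assoc, ih]
      refine Finsupp.lhom_ext fun s c => ?_
      rw [Module.End.mul_apply, hEnd_single, hEnd_single, hEnd_single, ← monomial_mul_X, map_mul,
        mul_assoc]

variable (q f g) in
/-- The action of `H_q(f,g)` on PBW coefficients by left multiplication. -/
def rep : QGHA F q f g →ₐ[F] Module.End F (Coeffs F) :=
  lift (xEnd F) (yEnd q f g) (hEnd f X)
    (by
      rw [aeval_hEnd]
      refine Finsupp.lhom_ext fun s c => ?_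
      simp [subst_pow_succ_apply, subst_X, -Finsupp.single_mul, -AlgHom.coe_pow])
    (by
      rw [aeval_hEnd]
      refine Finsupp.lhom_ext fun ⟨i, k⟩ c => ?_
      cases i with
      | zero => simp [correction, subst_X, -Finsupp.single_mul, -AlgHom.coe_pow]
      | succ i =>
        simp only [Module.End.mul_apply, hEnd_single, yEnd_single, map_add, map_mul,
          mul_smul_comm, Nat.add_sub_cancel]
        rw [← subst_pow_succ_apply', subst_pow_succ_apply (i + 1) X, subst_pow_succ_apply i X,
          subst_X, mul_left_comm])
    (by
      rw [aeval_hEnd]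
      refine Finsupp.lhom_ext fun ⟨i, k⟩ c => ?_
      cases i with
      | zero => simp [correction]
      | succ i =>
        simp only [Module.End.mul_apply, xEnd_single, hEnd_single, yEnd_single, map_add,
          Nat.add_sub_cancel, LinearMap.add_apply, LinearMap.smul_apply, smul_add,
          Finsupp.smul_single, smul_smul]
        rw [correction_succ (i + 1), add_mul, smul_mul_assoc, Finsupp.single_add, ← add_assoc,
          pow_succ' q (i + 1)])

@[simp] theorem rep_x : rep q f g (x q f g) = xEnd F := lift_x
@[simp] theorem rep_y : rep q f g (y q f g) = yEnd q f g := lift_y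
@[simp] theorem rep_h : rep q f g (h q f g) = hEnd f X := lift_h

variable (q f g) in
/-- The element `x ^ i * c(h) * y ^ k`, as a linear function of `c`. -/
def mono (s : ℕ × ℕ) : F[X] →ₗ[F] QGHA F q f g :=
  LinearMap.mulRight F (y q f g ^ s.2) ∘ₗ LinearMap.mulLeft F (x q f g ^ s.1) ∘ₗ
    (aeval (h q f g)).toLinearMap

theorem mono_apply (s : ℕ × ℕ) (c : F[X]) :
    mono q f g s c = x q f g ^ s.1 * aeval (h q f g) c * y q f g ^ s.2 := rfl

theorem aeval_h_mul_x (p : F[X]) :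
    aeval (h q f g) p * x q f g = x q f g * aeval (h q f g) (subst f p) := by
  induction p using Polynomial.induction_on' with
  | add p r hp hr => simp [add_mul, mul_add, hp, hr]
  | monomial n r =>
    induction n with
    | zero => simp [subst, Algebra.commutes]
    | succ n ih =>
      rw [← monomial_mul_X, map_mul, mul_assoc, aeval_X, h_mul_x, ← mul_assoc, ih, map_mul,
        map_mul, subst_X, mul_assoc]

theorem y_mul_aeval_h (p : F[X]) :
    y q f g * aeval (h q f g) p = aeval (h q f g) (subst f p) * y q f g := by
  induction p using Polynomial.induction_on' with
  | add p r hp hr => simp [add_mul, mul_add, hp, hr]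
  | monomial n r =>
    induction n with
    | zero => simp [subst, Algebra.commutes]
    | succ n ih =>
      rw [← monomial_mul_X, map_mul, ← mul_assoc, ih, aeval_X, mul_assoc, y_mul_h, ← mul_assoc,
        map_mul, map_mul, subst_X]

theorem aeval_h_mul_x_pow (p : F[X]) (n : ℕ) :
    aeval (h q f g) p * x q f g ^ n = x q f g ^ n * aeval (h q f g) ((subst f ^ n) p) := by
  induction n generalizing p with
  | zero => simp
  | succ n ih =>
    rw [pow_succ', ← mul_assoc, aeval_h_mul_x, mul_assoc, ih, subst_pow_succ_apply, mul_assoc]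

theorem y_pow_mul_aeval_h (p : F[X]) (n : ℕ) :
    y q f g ^ n * aeval (h q f g) p = aeval (h q f g) ((subst f ^ n) p) * y q f g ^ n := by
  induction n generalizing p with
  | zero => simp
  | succ n ih =>
    rw [pow_succ, mul_assoc, y_mul_aeval_h, ← mul_assoc, ih, subst_pow_succ_apply, mul_assoc]

theorem y_mul_x_pow (n : ℕ) :
    y q f g * x q f g ^ n = q ^ n • (x q f g ^ n * y q f g) +
      x q f g ^ (n - 1) * aeval (h q f g) (correction q f g n) := by
  induction n with
  | zero => simp [correction]
  | succ n ih =>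
    have key : x q f g * (x q f g ^ (n - 1) * aeval (h q f g) (correction q f g n)) =
        x q f g ^ n * aeval (h q f g) (correction q f g n) := by
      cases n with
      | zero => simp [correction]
      | succ n => rw [← mul_assoc, Nat.add_sub_cancel, ← pow_succ']
    rw [pow_succ', ← mul_assoc, y_mul_x, add_mul, smul_mul_assoc, mul_assoc, ih, mul_add, key,
      aeval_h_mul_x_pow, Nat.add_sub_cancel, correction, map_add, map_smul, mul_add,
      mul_smul_comm, mul_smul_comm, smul_add, smul_smul, pow_succ', mul_assoc, add_assoc]

theorem x_mul_mono (s : ℕ × ℕ) (c : F[X]) :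
    x q f g * mono q f g s c = mono q f g (s.1 + 1, s.2) c := by
  simp only [mono_apply, pow_succ', mul_assoc]

theorem mono_mul_y (s : ℕ × ℕ) (c : F[X]) :
    mono q f g s c * y q f g = mono q f g (s.1, s.2 + 1) c := by
  simp only [mono_apply, pow_succ, mul_assoc]

theorem aeval_h_mul_mono (p : F[X]) (s : ℕ × ℕ) (c : F[X]) :
    aeval (h q f g) p * mono q f g s c = mono q f g s ((subst f ^ s.1) p * c) := by
  simp only [mono_apply, ← mul_assoc, aeval_h_mul_x_pow, map_mul]

theorem mono_mul_aeval_h (p : F[X]) (s : ℕ × ℕ) (c : F[X]) :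
    mono q f g s c * aeval (h q f g) p = mono q f g s (c * (subst f ^ s.2) p) := by
  simp only [mono_apply, mul_assoc, y_pow_mul_aeval_h, map_mul]

theorem y_mul_mono (s : ℕ × ℕ) (c : F[X]) :
    y q f g * mono q f g s c = mono q f g (s.1, s.2 + 1) (q ^ s.1 • subst f c) +
      mono q f g (s.1 - 1, s.2) (correction q f g s.1 * c) := by
  simp only [mono_apply, ← mul_assoc, y_mul_x_pow, map_mul, map_smul, add_mul]
  congr 1
  rw [smul_mul_assoc, smul_mul_assoc, mul_assoc (x q f g ^ s.1), y_mul_aeval_h, pow_succ']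
  simp only [mul_assoc]

theorem aeval_h_eq_mono (p : F[X]) : aeval (h q f g) p = mono q f g 0 p := by
  simp [mono_apply]

theorem x_eq_mono : x q f g = mono q f g (1, 0) 1 := by simp [mono_apply]

theorem y_eq_mono : y q f g = mono q f g (0, 1) 1 := by simp [mono_apply]

variable (q f g) in
/-- The element with given PBW coefficients. -/
def ofCoeffs : Coeffs F →ₗ[F] QGHA F q f g := Finsupp.lsum F (mono q f g)

theorem ofCoeffs_single (s : ℕ × ℕ) (c : F[X]) :
    ofCoeffs q f g (Finsupp.single s c) = mono q f g s c := by
  simp [ofCoeffs]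

theorem ofCoeffs_rep (a : QGHA F q f g) (m : Coeffs F) :
    ofCoeffs q f g (rep q f g a m) = a * ofCoeffs q f g m := by
  induction a using QGHA.induction generalizing m with
  | algebraMap r => simp [Algebra.algebraMap_eq_smul_one]
  | x =>
    induction m using Finsupp.induction_linear with
    | zero => simp
    | add a b ha hb => simp only [map_add, ha, hb, mul_add]
    | single s c => simp [ofCoeffs_single, x_mul_mono]
  | y =>
    induction m using Finsupp.induction_linear with
    | zero => simp
    | add a b ha hb => simp only [map_add, ha, hb, mul_add]
    | single s c =>
      rw [rep_y, yEnd_single, map_add, ofCoeffs_single, ofCoeffs_single, ofCoeffs_single, y_mul_mono]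
  | h =>
    induction m using Finsupp.induction_linear with
    | zero => simp
    | add a b ha hb => simp only [map_add, ha, hb, mul_add]
    | single s c =>
      rw [rep_h, hEnd_single, ofCoeffs_single, ofCoeffs_single, ← aeval_h_mul_mono, aeval_X]
  | mul a b ha hb => simp [ha, hb, mul_assoc]
  | add a b ha hb => simp [ha, hb, add_mul]

variable (q f g) in
/-- The PBW coefficients of an element of `H_q(f,g)`. -/
def coeffs : QGHA F q f g →ₗ[F] Coeffs F :=
  LinearMap.applyₗ (Finsupp.single 0 1) ∘ₗ (rep q f g).toLinearMap

theorem coeffs_apply (a : QGHA F q f g) :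
    coeffs q f g a = rep q f g a (Finsupp.single 0 1) := rfl

theorem ofCoeffs_coeffs (a : QGHA F q f g) : ofCoeffs q f g (coeffs q f g a) = a := by
  rw [coeffs_apply, ofCoeffs_rep, ofCoeffs_single]
  simp [mono_apply]

@[simp]
theorem coeffs_mono (s : ℕ × ℕ) (c : F[X]) :
    coeffs q f g (mono q f g s c) = Finsupp.single s c := by
  have hy (k : ℕ) : (yEnd q f g ^ k) (Finsupp.single 0 1) = Finsupp.single (0, k) 1 := by
    induction k with
    | zero => rfl
    | succ k ih => simp [pow_succ', ih, correction]
  have hx (i k : ℕ) : (xEnd F ^ i) (Finsupp.single (0, k) c) = Finsupp.single (i, k) c := by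
    induction i with
    | zero => rfl
    | succ i ih => simp [pow_succ', ih]
  simp [coeffs_apply, mono_apply, ← aeval_algHom_apply, aeval_hEnd, hy, hx]

theorem coeffs_injective : Function.Injective (coeffs q f g) :=
  Function.LeftInverse.injective ofCoeffs_coeffs

theorem eq_sum_mono (a : QGHA F q f g) :
    a = ∑ s ∈ (coeffs q f g a).support, mono q f g s (coeffs q f g a s) := by
  conv_lhs => rw [← ofCoeffs_coeffs a]
  simp [ofCoeffs, Finsupp.sum]

theorem mono_injective (s : ℕ × ℕ) : Function.Injective (mono q f g s) := fun c e hce => by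
  exact Finsupp.single_injective s (by simpa only [coeffs_mono] using congrArg (coeffs q f g) hce)

theorem aeval_h_injective : Function.Injective (aeval (R := F) (h q f g)) := fun c e hce => by
  simp only [aeval_h_eq_mono] at hce
  exact mono_injective 0 hce

theorem coeffs_aeval_h_mul (p : F[X]) (a : QGHA F q f g) (s : ℕ × ℕ) :
    coeffs q f g (aeval (h q f g) p * a) s = (subst f ^ s.1) p * coeffs q f g a s := by
  conv_lhs => rw [eq_sum_mono a]
  simp +contextual [Finset.mul_sum, aeval_h_mul_mono, Finsupp.single_apply]

theorem coeffs_mul_aeval_h (p : F[X]) (a : QGHA F q f g) (s : ℕ × ℕ) :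
    coeffs q f g (a * aeval (h q f g) p) s = coeffs q f g a s * (subst f ^ s.2) p := by
  conv_lhs => rw [eq_sum_mono a]
  simp +contextual [Finset.sum_mul, mono_mul_aeval_h, Finsupp.single_apply]

/-! ### Leading terms -/

/-- The position of `x ^ i * h ^ j * y ^ k` in the order by total degree in `x` and `y`, with ties
broken by the degree in `x`. -/
def key (s : ℕ × ℕ) : ℕ ×ₗ ℕ := toLex (s.1 + s.2, s.1)

theorem key_lt_key {s t : ℕ × ℕ} :
    key s < key t ↔ s.1 + s.2 < t.1 + t.2 ∨ s.1 + s.2 = t.1 + t.2 ∧ s.1 < t.1 := by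
  simp [key, Prod.Lex.toLex_lt_toLex]

theorem key_injective : Function.Injective key := by
  rintro ⟨a, b⟩ ⟨c, d⟩ hs
  simp only [key, EmbeddingLike.apply_eq_iff_eq, Prod.mk.injEq] at hs
  ext <;> simp <;> omega

theorem key_zero : key 0 = 0 := rfl

theorem key_add (s t : ℕ × ℕ) : key (s + t) = key s + key t := by
  simp only [key, ← toLex_add, Prod.mk_add_mk, Prod.fst_add, Prod.snd_add]
  congr 2
  omega

theorem key_pos {s : ℕ × ℕ} (hs : s ≠ 0) : key 0 < key s := by
  obtain ⟨a, b⟩ := s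
  have : a ≠ 0 ∨ b ≠ 0 := by
    by_contra! hab
    exact hs (Prod.ext hab.1 hab.2)
  rw [key_lt_key]
  simp only [Prod.fst_zero, Prod.snd_zero]
  omega

theorem not_key_lt_zero (s : ℕ × ℕ) : ¬ key s < key 0 := by
  rw [key_lt_key]
  simp

variable (q f g) in
/-- The span of the PBW monomials of position less than `d`. -/
def lower (d : ℕ ×ₗ ℕ) : Submodule F (QGHA F q f g) :=
  Submodule.span F {a | ∃ s c, key s < d ∧ mono q f g s c = a}

theorem mono_mem_lower {s : ℕ × ℕ} {d : ℕ ×ₗ ℕ} (hs : key s < d) (c : F[X]) :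
    mono q f g s c ∈ lower q f g d :=
  Submodule.subset_span ⟨s, c, hs, rfl⟩

theorem lower_mono {d e : ℕ ×ₗ ℕ} (hde : d ≤ e) : lower q f g d ≤ lower q f g e := by
  refine Submodule.span_le.2 ?_
  rintro _ ⟨s, c, hs, rfl⟩
  exact mono_mem_lower (hs.trans_le hde) c

theorem coeffs_eq_zero_of_mem_lower {d : ℕ ×ₗ ℕ} {a : QGHA F q f g} (ha : a ∈ lower q f g d)
    {s : ℕ × ℕ} (hs : d ≤ key s) : coeffs q f g a s = 0 := by
  induction ha using Submodule.span_induction with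
  | mem a ha =>
    obtain ⟨t, c, ht, rfl⟩ := ha
    rw [coeffs_mono, Finsupp.single_apply, if_neg]
    rintro rfl
    exact hs.not_gt ht
  | zero => simp
  | add a b _ _ ha hb => simp [ha, hb]
  | smul r a _ ha => simp [ha]

/-- To map `lower d` into `lower e` by a linear map, it suffices to do so on PBW monomials. -/
theorem map_mem_lower {d e : ℕ ×ₗ ℕ} (φ : QGHA F q f g →ₗ[F] QGHA F q f g)
    (hφ : ∀ s c, key s < d → φ (mono q f g s c) ∈ lower q f g e) {a : QGHA F q f g}
    (ha : a ∈ lower q f g d) : φ a ∈ lower q f g e := by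
  suffices lower q f g d ≤ (lower q f g e).comap φ from this ha
  refine Submodule.span_le.2 ?_
  rintro _ ⟨s, c, hs, rfl⟩
  exact hφ s c hs

theorem x_pow_mul_mono (n : ℕ) (s : ℕ × ℕ) (c : F[X]) :
    x q f g ^ n * mono q f g s c = mono q f g ((n, 0) + s) c := by
  simp only [mono_apply, ← mul_assoc, ← pow_add, Prod.fst_add, Prod.snd_add, zero_add]

theorem x_pow_mul_mem_lower (n : ℕ) {d : ℕ ×ₗ ℕ} {a : QGHA F q f g} (ha : a ∈ lower q f g d) :
    x q f g ^ n * a ∈ lower q f g (key (n, 0) + d) := by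
  refine map_mem_lower (LinearMap.mulLeft F (x q f g ^ n)) (fun s c hs => ?_) ha
  rw [LinearMap.mulLeft_apply, x_pow_mul_mono]
  refine mono_mem_lower ?_ _
  rw [key_add]
  gcongr

theorem aeval_h_mul_mem_lower (p : F[X]) {d : ℕ ×ₗ ℕ} {a : QGHA F q f g}
    (ha : a ∈ lower q f g d) : aeval (h q f g) p * a ∈ lower q f g d := by
  refine map_mem_lower (LinearMap.mulLeft F (aeval (h q f g) p)) (fun s c hs => ?_) ha
  rw [LinearMap.mulLeft_apply, aeval_h_mul_mono]
  exact mono_mem_lower hs _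

theorem y_mul_mono_sub_mem_lower (s : ℕ × ℕ) (c : F[X]) :
    y q f g * mono q f g s c - mono q f g (s + (0, 1)) (q ^ s.1 • subst f c) ∈
      lower q f g (key (s + (0, 1))) := by
  have hs : s + (0, 1) = (s.1, s.2 + 1) := rfl
  rw [hs, y_mul_mono, add_sub_cancel_left]
  refine mono_mem_lower (key_lt_key.2 (Or.inl ?_)) _
  dsimp only
  omega

theorem y_mul_mem_lower {d : ℕ ×ₗ ℕ} {a : QGHA F q f g} (ha : a ∈ lower q f g d) :
    y q f g * a ∈ lower q f g (d + key (0, 1)) := by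
  refine map_mem_lower (LinearMap.mulLeft F (y q f g)) (fun s c hs => ?_) ha
  have hlt : key (s + (0, 1)) < d + key (0, 1) := by
    rw [key_add]
    gcongr
  rw [LinearMap.mulLeft_apply, ← sub_add_cancel (y q f g * mono q f g s c)]
  exact add_mem (lower_mono hlt.le (y_mul_mono_sub_mem_lower s c)) (mono_mem_lower hlt _)

theorem y_pow_mul_mem_lower (n : ℕ) {d : ℕ ×ₗ ℕ} {a : QGHA F q f g} (ha : a ∈ lower q f g d) :
    y q f g ^ n * a ∈ lower q f g (key (0, n) + d) := by
  induction n with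
  | zero => simpa [← Prod.zero_eq_mk, key_zero] using ha
  | succ n ih =>
    have hn : ((0, n + 1) : ℕ × ℕ) = (0, n) + (0, 1) := rfl
    rw [pow_succ', mul_assoc, hn, key_add, add_right_comm]
    exact y_mul_mem_lower ih

theorem y_pow_mul_mono_sub_mem_lower (n : ℕ) (s : ℕ × ℕ) (c : F[X]) :
    y q f g ^ n * mono q f g s c -
        mono q f g (s + (0, n)) (q ^ (s.1 * n) • (subst f ^ n) c) ∈
      lower q f g (key (s + (0, n))) := by
  induction n with
  | zero => simp [← Prod.zero_eq_mk]
  | succ n ih =>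
    have h₁ := y_mul_mem_lower ih
    have h₂ := y_mul_mono_sub_mem_lower (q := q) (f := f) (g := g) (s + (0, n))
      (q ^ (s.1 * n) • (subst f ^ n) c)
    have hs : s + (0, n) + (0, 1) = s + (0, n + 1) := rfl
    rw [← key_add, hs] at h₁
    rw [hs] at h₂
    convert add_mem h₁ h₂ using 1
    rw [mul_sub, pow_succ' (y q f g), mul_assoc, sub_add_sub_cancel]
    congr 2
    rw [map_smul, smul_smul, subst_pow_succ_apply', mul_add_one, pow_add, mul_comm]
    rfl

theorem mono_mul_mem_lower (s : ℕ × ℕ) (c : F[X]) {d : ℕ ×ₗ ℕ} {a : QGHA F q f g}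
    (ha : a ∈ lower q f g d) : mono q f g s c * a ∈ lower q f g (key s + d) := by
  have hs : s = (s.1, 0) + (0, s.2) := by simp
  rw [hs, key_add, add_assoc, mono_apply, mul_assoc, mul_assoc]
  simpa using x_pow_mul_mem_lower s.1
    (aeval_h_mul_mem_lower c (y_pow_mul_mem_lower s.2 ha))

theorem mono_mul_mono_sub_mem_lower (s t : ℕ × ℕ) (c e : F[X]) :
    mono q f g s c * mono q f g t e -
        mono q f g (s + t) (q ^ (t.1 * s.2) • ((subst f ^ t.1) c * (subst f ^ s.2) e)) ∈
      lower q f g (key (s + t)) := by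
  have hmem := x_pow_mul_mem_lower s.1 (aeval_h_mul_mem_lower c
    (y_pow_mul_mono_sub_mem_lower (q := q) (f := f) (g := g) s.2 t e))
  have hst : (s.1, 0) + (t + (0, s.2)) = s + t := by
    ext <;> simp [add_comm]
  rw [← key_add, hst, mul_sub, mul_sub, aeval_h_mul_mono, x_pow_mul_mono, hst] at hmem
  simpa [mono_apply s, mul_assoc] using hmem

theorem mul_mem_lower {d e : ℕ ×ₗ ℕ} {a b : QGHA F q f g} (ha : a ∈ lower q f g d)
    (hb : b ∈ lower q f g e) : a * b ∈ lower q f g (d + e) := by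
  refine map_mem_lower (LinearMap.mulRight F b) (fun s c hs => ?_) ha
  exact lower_mono (add_le_add_left hs.le e) (mono_mul_mem_lower s c hb)

theorem mul_mono_mem_lower (t : ℕ × ℕ) (e : F[X]) {d : ℕ ×ₗ ℕ} {a : QGHA F q f g}
    (ha : a ∈ lower q f g d) : a * mono q f g t e ∈ lower q f g (d + key t) := by
  refine map_mem_lower (LinearMap.mulRight F (mono q f g t e)) (fun s c hs => ?_) ha
  have hlt : key (s + t) < d + key t := by
    rw [key_add]
    gcongr
  rw [LinearMap.mulRight_apply, ← sub_add_cancel (mono q f g s c * mono q f g t e)]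
  exact add_mem (lower_mono hlt.le (mono_mul_mono_sub_mem_lower s t c e)) (mono_mem_lower hlt _)

/-- `a` has leading term `x ^ s.1 * c(h) * y ^ s.2`. -/
def HasLead (a : QGHA F q f g) (s : ℕ × ℕ) (c : F[X]) : Prop :=
  c ≠ 0 ∧ a - mono q f g s c ∈ lower q f g (key s)

theorem exists_hasLead {a : QGHA F q f g} (ha : a ≠ 0) : ∃ s c, HasLead a s c := by
  have hne : (coeffs q f g a).support.Nonempty := by
    rw [Finsupp.support_nonempty_iff]
    exact fun h0 => ha (coeffs_injective (h0.trans (map_zero _).symm))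
  obtain ⟨s, hs, hmax⟩ := Finset.exists_max_image _ key hne
  refine ⟨s, coeffs q f g a s, Finsupp.mem_support_iff.1 hs, ?_⟩
  have hsum := eq_sum_mono a
  rw [← Finset.add_sum_erase _ _ hs] at hsum
  nth_rw 1 [hsum]
  rw [add_sub_cancel_left]
  refine sum_mem fun t ht => mono_mem_lower ?_ _
  rw [Finset.mem_erase] at ht
  exact (hmax t ht.2).lt_of_ne fun hst => ht.1 (key_injective hst)

theorem hasLead_mono (s : ℕ × ℕ) {c : F[X]} (hc : c ≠ 0) : HasLead (mono q f g s c) s c :=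
  ⟨hc, by simp⟩

namespace HasLead

variable {a b : QGHA F q f g} {s t : ℕ × ℕ} {c e : F[X]}

theorem coeffs_eq (ha : HasLead a s c) : coeffs q f g a s = c := by
  simpa [sub_eq_zero] using coeffs_eq_zero_of_mem_lower ha.2 le_rfl

theorem coeffs_eq_zero (ha : HasLead a s c) (hst : key s < key t) : coeffs q f g a t = 0 := by
  have hne : s ≠ t := fun h => hst.ne (congrArg key h)
  simpa [Finsupp.single_apply, hne] using coeffs_eq_zero_of_mem_lower ha.2 hst.le

theorem ne_zero (ha : HasLead a s c) : a ≠ 0 := by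
  rintro rfl
  exact ha.1 (by simpa using ha.coeffs_eq.symm)

theorem index_unique (ha : HasLead a s c) (ha' : HasLead a t e) : s = t := by
  rcases lt_trichotomy (key s) (key t) with hlt | heq | hgt
  · exact absurd (ha'.coeffs_eq.symm.trans (ha.coeffs_eq_zero hlt)) ha'.1
  · exact key_injective heq
  · exact absurd (ha.coeffs_eq.symm.trans (ha'.coeffs_eq_zero hgt)) ha.1

theorem add_mem_lower (ha : HasLead a s c) (hb : b ∈ lower q f g (key s)) :
    HasLead (a + b) s c :=
  ⟨ha.1, by simpa only [add_sub_right_comm] using add_mem ha.2 hb⟩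

theorem eq_aeval_h (ha : HasLead a 0 c) : a = aeval (h q f g) c := by
  have hbot : lower q f g (key 0) = ⊥ := by
    rw [lower, Submodule.span_eq_bot]
    rintro _ ⟨s, _, hs, _⟩
    exact absurd hs (not_key_lt_zero s)
  simpa [hbot, sub_eq_zero, aeval_h_eq_mono] using ha.2

end HasLead

theorem subst_pow_injective (hf : 0 < f.natDegree) (n : ℕ) :
    Function.Injective (subst f ^ n) := by
  rw [AlgHom.coe_pow]
  refine Function.Injective.iterate ?_ n
  rw [injective_iff_map_eq_zero]
  intro p hp
  rw [subst_apply, comp_eq_zero_iff] at hp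
  refine hp.resolve_right fun hC => ?_
  rw [hC.2, natDegree_C] at hf
  exact hf.ne rfl

theorem natDegree_subst_pow (n : ℕ) (p : F[X]) :
    ((subst f ^ n) p).natDegree = p.natDegree * f.natDegree ^ n := by
  induction n with
  | zero => simp
  | succ n ih => rw [subst_pow_succ_apply', subst_apply, natDegree_comp, ih, pow_succ, mul_assoc]

theorem HasLead.mul (hq : q ≠ 0) (hf : 0 < f.natDegree) {a b : QGHA F q f g} {s t : ℕ × ℕ}
    {c e : F[X]} (ha : HasLead a s c) (hb : HasLead b t e) :
    HasLead (a * b) (s + t) (q ^ (t.1 * s.2) • ((subst f ^ t.1) c * (subst f ^ s.2) e)) := by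
  refine ⟨smul_ne_zero (pow_ne_zero _ hq) (mul_ne_zero ?_ ?_), ?_⟩
  · exact (map_ne_zero_iff _ (subst_pow_injective hf _)).2 ha.1
  · exact (map_ne_zero_iff _ (subst_pow_injective hf _)).2 hb.1
  · have h₁ := mul_mem_lower ha.2 hb.2
    have h₂ := mono_mul_mem_lower s c hb.2
    have h₃ := mul_mono_mem_lower t e ha.2
    rw [← key_add] at h₁ h₂ h₃
    convert add_mem (add_mem (add_mem h₁ h₂) h₃) (mono_mul_mono_sub_mem_lower s t c e) using 1
    noncomm_ring

theorem noZeroDivisors (hq : q ≠ 0) (hf : 0 < f.natDegree) : NoZeroDivisors (QGHA F q f g) where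
  eq_zero_or_eq_zero_of_mul_eq_zero {a b} hab := by
    by_contra! hne
    obtain ⟨s, c, ha⟩ := exists_hasLead hne.1
    obtain ⟨t, e, hb⟩ := exists_hasLead hne.2
    exact (ha.mul hq hf hb).ne_zero hab

theorem HasLead.aeval (hq : q ≠ 0) (hf : 0 < f.natDegree) {a : QGHA F q f g} {s : ℕ × ℕ}
    {c : F[X]} (hs : s ≠ 0) (ha : HasLead a s c) {p : F[X]} (hp : p ≠ 0) :
    ∃ e, HasLead (aeval a p) (p.natDegree • s) e := by
  have hC (r : F) : algebraMap F (QGHA F q f g) r = mono q f g 0 (C r) := by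
    rw [← aeval_h_eq_mono, aeval_C]
  induction hn : p.natDegree generalizing p with
  | zero =>
    rw [eq_C_of_natDegree_eq_zero hn] at hp ⊢
    rw [aeval_C, hC, zero_smul]
    exact ⟨_, hasLead_mono 0 hp⟩
  | succ n ih =>
    have hdiv : p.divX.natDegree = n := by
      rw [natDegree_divX_eq_natDegree_tsub_one, hn, Nat.add_sub_cancel]
    have hdiv0 : p.divX ≠ 0 := fun h0 => by
      rw [divX_eq_zero_iff] at h0
      rw [h0, natDegree_C] at hn
      exact absurd hn (Nat.succ_ne_zero n).symm
    obtain ⟨e, he⟩ := ih hdiv0 hdiv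
    have hmul := he.mul hq hf ha
    rw [← succ_nsmul] at hmul
    rw [← divX_mul_X_add p, map_add, map_mul, aeval_X, aeval_C, hC]
    exact ⟨_, hmul.add_mem_lower
      (mono_mem_lower (key_pos (smul_ne_zero (Nat.succ_ne_zero n) hs)) _)⟩

/-- An element satisfying the relation between `h` and `x` for a polynomial of degree at least two
is a polynomial in `h`. -/
theorem exists_eq_aeval_h (hq : q ≠ 0) (hf : 0 < f.natDegree) {H Z : QGHA F q f g} {p : F[X]}
    (hp : 1 < p.natDegree) (hZ : Z ≠ 0) (hHZ : H * Z = Z * aeval H p) :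
    ∃ r : F[X], H = aeval (h q f g) r := by
  rcases eq_or_ne H 0 with rfl | hH
  · exact ⟨0, by simp⟩
  obtain ⟨s, c, hs⟩ := exists_hasLead hH
  obtain ⟨t, e, ht⟩ := exists_hasLead hZ
  rcases eq_or_ne s 0 with rfl | hs0
  · exact ⟨c, hs.eq_aeval_h⟩
  have hp0 : p ≠ 0 := by
    rintro rfl
    simp at hp
  obtain ⟨w, hw⟩ := hs.aeval hq hf hs0 hp0
  have hlead := hs.mul hq hf ht
  rw [hHZ, add_comm] at hlead
  have heq := add_left_cancel (hlead.index_unique (ht.mul hq hf hw))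
  refine absurd ?_ hs0
  have h₁ := congrArg Prod.fst heq
  have h₂ := congrArg Prod.snd heq
  simp only [Prod.smul_fst, Prod.smul_snd, smul_eq_mul] at h₁ h₂
  ext
  · exact of_not_not fun h0 => hp.ne (Nat.eq_of_mul_eq_mul_right (Nat.pos_of_ne_zero h0)
      ((one_mul _).trans h₁))
  · exact of_not_not fun h0 => hp.ne (Nat.eq_of_mul_eq_mul_right (Nat.pos_of_ne_zero h0)
      ((one_mul _).trans h₂))

/-- The factors of `1` are scalars. -/
theorem exists_eq_algebraMap_of_mul_eq_one (hq : q ≠ 0) (hf : 0 < f.natDegree)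
    {u v : QGHA F q f g} (huv : u * v = 1) :
    (∃ r, u = algebraMap F _ r) ∧ ∃ r, v = algebraMap F _ r := by
  have hone : HasLead (1 : QGHA F q f g) 0 1 := by
    simpa [mono_apply] using hasLead_mono (q := q) (f := f) (g := g) 0 one_ne_zero
  have hu : u ≠ 0 := by
    rintro rfl
    exact hone.ne_zero (by simp [← huv])
  have hv : v ≠ 0 := by
    rintro rfl
    exact hone.ne_zero (by simp [← huv])
  obtain ⟨s, c, hs⟩ := exists_hasLead hu
  obtain ⟨t, e, ht⟩ := exists_hasLead hv
  have hst := hs.mul hq hf ht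
  rw [huv] at hst
  obtain ⟨rfl, rfl⟩ : s = 0 ∧ t = 0 := add_eq_zero.1 (hst.index_unique hone)
  have hce : c * e = 1 := aeval_h_injective (q := q) (f := f) (g := g) <| by
    rw [map_mul, map_one, ← hs.eq_aeval_h, ← ht.eq_aeval_h, huv]
  rw [hs.eq_aeval_h, ht.eq_aeval_h]
  obtain ⟨r, -, rfl⟩ := isUnit_iff.1 (IsUnit.of_mul_eq_one _ hce)
  obtain ⟨r', -, rfl⟩ := isUnit_iff.1 (IsUnit.of_mul_eq_one_right _ hce)
  exact ⟨⟨r, aeval_C _ _⟩, r', aeval_C _ _⟩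

/-! ### Zero divisors -/

theorem x_ne_zero : x q f g ≠ 0 := by
  rw [x_eq_mono]
  exact (hasLead_mono _ one_ne_zero).ne_zero

theorem y_ne_zero : y q f g ≠ 0 := by
  rw [y_eq_mono]
  exact (hasLead_mono _ one_ne_zero).ne_zero

theorem natDegree_pos_of_noZeroDivisors [NoZeroDivisors (QGHA F q f g)] : 0 < f.natDegree := by
  rw [Nat.pos_iff_ne_zero]
  intro hf
  obtain ⟨c, rfl⟩ := natDegree_eq_zero.1 hf
  have hmul : aeval (h q (C c) g) (X - C c) * x q (C c) g = 0 := by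
    rw [map_sub, sub_mul, aeval_X, h_mul_x, aeval_C, Algebra.commutes, sub_self]
  rcases mul_eq_zero.1 hmul with h0 | h0
  · exact X_sub_C_ne_zero c (aeval_h_injective (h0.trans (map_zero _).symm))
  · exact x_ne_zero h0

/-- Some nonzero polynomial in `f` is divisible by `g`. -/
theorem exists_dvd_comp (f : F[X]) {g : F[X]} (hg : g ≠ 0) : ∃ p : F[X], p ≠ 0 ∧ g ∣ p.comp f := by
  have : Module.Finite F (AdjoinRoot g) := (AdjoinRoot.powerBasis hg).finite
  refine ⟨minpoly F (AdjoinRoot.mk g f), minpoly.ne_zero (IsIntegral.of_finite F _), ?_⟩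
  rw [← AdjoinRoot.mk_eq_zero, ← subst_apply, subst, ← AdjoinRoot.coe_mkₐ, ← aeval_algHom_apply]
  exact minpoly.aeval F _

theorem ne_zero_of_noZeroDivisors [NoZeroDivisors (QGHA F q f g)] : q ≠ 0 := by
  rintro rfl
  have hyx : y 0 f g * x 0 f g = aeval (h 0 f g) g := by rw [y_mul_x, zero_smul, zero_add]
  rcases eq_or_ne g 0 with rfl | hg
  · rw [map_zero] at hyx
    exact (mul_eq_zero.1 hyx).elim y_ne_zero x_ne_zero
  obtain ⟨p, hp, u, hu⟩ := exists_dvd_comp f hg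
  have hmul : y 0 f g * (mono 0 f g (1, 1) u - aeval (h 0 f g) p) = 0 := by
    rw [mul_sub, y_mul_aeval_h, subst_apply, hu, mono_apply, map_mul, pow_one, pow_one,
      ← mul_assoc, ← mul_assoc, hyx, sub_self]
  refine y_ne_zero ((mul_eq_zero.1 hmul).resolve_right fun h0 => hp ?_)
  have := congrArg (fun a => coeffs 0 f g a 0) h0
  simpa [aeval_h_eq_mono, Finsupp.single_apply] using this

/-! ### Elements satisfying the relations of the generators -/

theorem exists_eq_x_mul {a : QGHA F q f g} (ha : ∀ s, coeffs q f g a s ≠ 0 → s.1 ≠ 0) :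
    ∃ u, a = x q f g * u := by
  refine ⟨∑ s ∈ (coeffs q f g a).support, mono q f g (s.1 - 1, s.2) (coeffs q f g a s), ?_⟩
  conv_lhs => rw [eq_sum_mono a]
  rw [Finset.mul_sum]
  refine Finset.sum_congr rfl fun s hs => ?_
  rw [x_mul_mono, Nat.sub_add_cancel
    (Nat.one_le_iff_ne_zero.2 (ha s (Finsupp.mem_support_iff.1 hs)))]

theorem exists_eq_mul_y {a : QGHA F q f g} (ha : ∀ s, coeffs q f g a s ≠ 0 → s.2 ≠ 0) :
    ∃ u, a = u * y q f g := by
  refine ⟨∑ s ∈ (coeffs q f g a).support, mono q f g (s.1, s.2 - 1) (coeffs q f g a s), ?_⟩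
  conv_lhs => rw [eq_sum_mono a]
  rw [Finset.sum_mul]
  refine Finset.sum_congr rfl fun s hs => ?_
  rw [mono_mul_y, Nat.sub_add_cancel
    (Nat.one_le_iff_ne_zero.2 (ha s (Finsupp.mem_support_iff.1 hs)))]

theorem lt_of_pow_eq_mul_pow {d e i k : ℕ} (hd : 1 < d) (he : 0 < e) (hik : e ^ i = d * e ^ k) :
    1 < e ∧ k < i := by
  have hk : 0 < e ^ k := pow_pos he k
  have hlt : e ^ k < e ^ i := by
    rw [hik]
    nlinarith
  refine ⟨lt_of_le_of_ne he ?_, lt_of_not_ge fun hle => hlt.not_ge (Nat.pow_le_pow_right he hle)⟩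
  rintro rfl
  simp at hlt

theorem index_lt_of_subst_pow_eq {p r : F[X]} (hf : 0 < f.natDegree) (hp : 1 < p.natDegree)
    (hr : 0 < r.natDegree) {i k : ℕ} (hik : (subst f ^ i) r = (subst f ^ k) (p.comp r)) :
    1 < f.natDegree ∧ k < i := by
  refine lt_of_pow_eq_mul_pow hp hf (Nat.eq_of_mul_eq_mul_left hr ?_)
  have := congrArg natDegree hik
  rw [natDegree_subst_pow, natDegree_subst_pow, natDegree_comp] at this
  rw [this]
  ring

section iso

variable {q' : F} {f' g' : F[X]}

/-- The images of the generators under an isomorphism, up to cofactors. -/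
theorem exists_of_algEquiv (φ : QGHA F q f g ≃ₐ[F] QGHA F q' f' g') (hq' : q' ≠ 0)
    (hf : 1 < f.natDegree) (hf' : 0 < f'.natDegree) :
    1 < f'.natDegree ∧ (∃ p : F[X], φ (h q f g) = aeval (h q' f' g') p) ∧
      (∃ u, φ (x q f g) = x q' f' g' * u) ∧ ∃ u, φ (y q f g) = u * y q' f' g' := by
  have hφx : φ (x q f g) ≠ 0 := (map_ne_zero_iff φ φ.injective).2 x_ne_zero
  have hhx : φ (h q f g) * φ (x q f g) = φ (x q f g) * aeval (φ (h q f g)) f := by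
    rw [← map_mul, h_mul_x, map_mul, aeval_algHom_apply]
  have hyh : φ (y q f g) * φ (h q f g) = aeval (φ (h q f g)) f * φ (y q f g) := by
    rw [← map_mul, y_mul_h, map_mul, aeval_algHom_apply]
  obtain ⟨p : F[X], hp⟩ := exists_eq_aeval_h hq' hf' hf hφx hhx
  have hpdeg : 0 < p.natDegree := by
    rw [Nat.pos_iff_ne_zero]
    intro h0
    obtain ⟨c, rfl⟩ := natDegree_eq_zero.1 h0
    have hX : aeval (h q f g) (X : F[X]) = aeval (h q f g) (C c) := φ.injective <| by
      rw [aeval_X, hp, aeval_C, aeval_C, AlgEquiv.commutes]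
    have := congrArg natDegree (aeval_h_injective hX)
    simp at this
  rw [hp, ← aeval_comp] at hhx hyh
  have hxs (s : ℕ × ℕ) (hs : coeffs q' f' g' (φ (x q f g)) s ≠ 0) :
      1 < f'.natDegree ∧ s.2 < s.1 := by
    refine index_lt_of_subst_pow_eq hf' hf hpdeg (mul_right_cancel₀ hs ?_)
    rw [← coeffs_aeval_h_mul, hhx, coeffs_mul_aeval_h, mul_comm]
  have hys (s : ℕ × ℕ) (hs : coeffs q' f' g' (φ (y q f g)) s ≠ 0) :
      1 < f'.natDegree ∧ s.1 < s.2 := by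
    refine index_lt_of_subst_pow_eq hf' hf hpdeg (mul_right_cancel₀ hs ?_)
    rw [← coeffs_aeval_h_mul, ← hyh, coeffs_mul_aeval_h, mul_comm]
  obtain ⟨s, c, hs⟩ := exists_hasLead hφx
  exact ⟨(hxs s (hs.coeffs_eq.trans_ne hs.1)).1, ⟨p, hp⟩,
    exists_eq_x_mul fun t ht => (hxs t ht).2.ne_bot, exists_eq_mul_y fun t ht => (hys t ht).2.ne_bot⟩

/-- An isomorphism rescales `x` and `y` and acts on `h` by an invertible substitution. -/
theorem exists_scalars_of_algEquiv (φ : QGHA F q f g ≃ₐ[F] QGHA F q' f' g') (hq : q ≠ 0)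
    (hf : 1 < f.natDegree) :
    ∃ (p r : F[X]) (lam mu : F), p.comp r = X ∧ φ (h q f g) = aeval (h q' f' g') p ∧
      φ (x q f g) = lam • x q' f' g' ∧ φ (y q f g) = mu • y q' f' g' := by
  have := noZeroDivisors (g := g) hq (zero_lt_one.trans hf)
  have : NoZeroDivisors (QGHA F q' f' g') :=
    φ.symm.injective.noZeroDivisors _ (map_zero _) (map_mul _)
  have hq' : q' ≠ 0 := ne_zero_of_noZeroDivisors (f := f') (g := g')
  have hf' : 0 < f'.natDegree := natDegree_pos_of_noZeroDivisors (q := q') (g := g')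
  obtain ⟨hf'1, ⟨p, hp⟩, ⟨u, hu⟩, ⟨v, hv⟩⟩ := exists_of_algEquiv φ hq' hf hf'
  obtain ⟨-, ⟨r, hr⟩, ⟨u', hu'⟩, ⟨v', hv'⟩⟩ :=
    exists_of_algEquiv φ.symm hq hf'1 (zero_lt_one.trans hf)
  have huu : u * φ u' = 1 := mul_left_cancel₀ (x_ne_zero (q := q') (f := f') (g := g')) <| by
    rw [← mul_assoc, ← hu, ← map_mul, ← hu', AlgEquiv.apply_symm_apply, mul_one]
  have hvv : φ v' * v = 1 := mul_right_cancel₀ (y_ne_zero (q := q') (f := f') (g := g')) <| by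
    rw [mul_assoc, ← hv, ← map_mul, ← hv', AlgEquiv.apply_symm_apply, one_mul]
  obtain ⟨⟨lam, rfl⟩, -⟩ := exists_eq_algebraMap_of_mul_eq_one hq' hf' huu
  obtain ⟨-, mu, rfl⟩ := exists_eq_algebraMap_of_mul_eq_one hq' hf' hvv
  refine ⟨p, r, lam, mu, ?_, hp, ?_, ?_⟩
  · refine aeval_h_injective (q := q) (f := f) (g := g) ?_
    rw [aeval_X, aeval_comp, ← hr, aeval_algHom_apply, ← hp, AlgEquiv.symm_apply_apply]
  · rw [hu, ← Algebra.commutes, Algebra.smul_def]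
  · rw [hv, Algebra.smul_def]

/-- The parameters of isomorphic algebras are related by an affine substitution. -/
theorem exists_affine_of_algEquiv (φ : QGHA F q f g ≃ₐ[F] QGHA F q' f' g') (hq : q ≠ 0)
    (hf : 1 < f.natDegree) :
    q = q' ∧ ∃ a b s : F, a ≠ 0 ∧ s ≠ 0 ∧
      (C a * X + C b).comp f' = f.comp (C a * X + C b) ∧ s • g' = g.comp (C a * X + C b) := by
  obtain ⟨p, r, lam, mu, hpr, hh, hx, hy⟩ := exists_scalars_of_algEquiv φ hq hf
  have hlam : lam ≠ 0 := by
    rintro rfl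
    rw [zero_smul] at hx
    exact x_ne_zero (φ.injective (hx.trans (map_zero φ).symm))
  have hmu : mu ≠ 0 := by
    rintro rfl
    rw [zero_smul] at hy
    exact y_ne_zero (φ.injective (hy.trans (map_zero φ).symm))
  have hf'p : p.comp f' = f.comp p := by
    have key : φ (h q f g * x q f g) = φ (x q f g * aeval (h q f g) f) := by rw [h_mul_x]
    rw [map_mul, map_mul, ← aeval_algHom_apply, hh, hx, mul_smul_comm, smul_mul_assoc,
      aeval_h_mul_x, ← aeval_comp, subst_apply] at key
    have := congrArg (fun a => coeffs q' f' g' a (1, 0)) (smul_right_injective _ hlam key)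
    simpa [aeval_h_eq_mono, x_mul_mono] using this
  have hyx : φ (y q f g * x q f g) = φ (q • (x q f g * y q f g) + aeval (h q f g) g) := by
    rw [y_mul_x]
  have hxy : x q' f' g' * y q' f' g' = mono q' f' g' (1, 1) 1 := by simp [mono_apply]
  rw [map_mul, map_add, map_smul, map_mul, ← aeval_algHom_apply, hh, hx, hy, ← aeval_comp,
    smul_mul_smul_comm, smul_mul_smul_comm, y_mul_x, hxy, aeval_h_eq_mono, aeval_h_eq_mono] at hyx
  have hqq : q = q' := by
    have := congrArg (fun a => (coeffs q' f' g' a (1, 1)).coeff 0) hyx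
    simp at this
    exact mul_left_cancel₀ (mul_ne_zero hlam hmu) (by linear_combination -this)
  have hgp : (lam * mu) • g' = g.comp p := by
    have := congrArg (fun a => coeffs q' f' g' a 0) hyx
    simpa [mul_comm lam] using this
  have hpdeg : p.natDegree = 1 := by
    have := congrArg natDegree hpr
    rw [natDegree_comp, natDegree_X] at this
    exact Nat.eq_one_of_mul_eq_one_right this
  obtain ⟨a, ha, b, rfl⟩ := natDegree_eq_one.1 hpdeg
  exact ⟨hqq, a, b, lam * mu, ha, mul_ne_zero hlam hmu, hf'p, hgp⟩

/-- The homomorphism acting on `h` by the substitution `p`, and rescaling `x`. -/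
def substHom (p : F[X]) (s : F) (hp : p.comp f' = f.comp p) (hs : s • g' = g.comp p) :
    QGHA F q f g →ₐ[F] QGHA F q f' g' :=
  lift (s • x q f' g') (y q f' g') (aeval (h q f' g') p)
    (by
      rw [mul_smul_comm, smul_mul_assoc, aeval_h_mul_x, subst_apply, hp, aeval_comp])
    (by rw [y_mul_aeval_h, subst_apply, hp, aeval_comp])
    (by
      rw [mul_smul_comm, smul_mul_assoc, y_mul_x, ← aeval_comp, ← hs, map_smul, smul_add,
        smul_comm])

theorem nonempty_algEquiv {p r : F[X]} {s : F} (hpr : p.comp r = X) (hrp : r.comp p = X)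
    (hs0 : s ≠ 0) (hp : p.comp f' = f.comp p) (hs : s • g' = g.comp p) :
    Nonempty (QGHA F q f g ≃ₐ[F] QGHA F q f' g') := by
  have hr : r.comp f = f'.comp r := by
    calc r.comp f = r.comp ((f.comp p).comp r) := by rw [comp_assoc, hpr, comp_X]
      _ = f'.comp r := by rw [← hp, ← comp_assoc, ← comp_assoc, hrp, X_comp]
  have hs' : s⁻¹ • g = g'.comp r := by
    rw [inv_smul_eq_iff₀ hs0, ← smul_comp, hs, comp_assoc, hpr, comp_X]
  refine ⟨AlgEquiv.ofAlgHom (substHom p s hp hs) (substHom r s⁻¹ hr hs')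
    (algHom_ext ?_ ?_ ?_) (algHom_ext ?_ ?_ ?_)⟩
  · simp [substHom, hs0]
  · simp [substHom]
  · simp [substHom, ← aeval_algHom_apply, ← aeval_comp, hrp]
  · simp [substHom, hs0]
  · simp [substHom]
  · simp [substHom, ← aeval_algHom_apply, ← aeval_comp, hpr]

end iso

end QGHA

end

theorem QGHAStep.nonempty_algEquiv {F : Type*} [Field F] (q : F) {P P' : F[X] × F[X]}
    (hP : QGHAStep F P P') : Nonempty (QGHA F q P.1 P.2 ≃ₐ[F] QGHA F q P'.1 P'.2) := by
  cases hP with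
  | typeI f g α =>
    exact QGHA.nonempty_algEquiv (p := X - C α) (r := X + C α) (s := 1) (by simp) (by simp)
      one_ne_zero (by simp) (by simp)
  | typeII f g lam hlam =>
    have hinv : (C lam⁻¹ * C lam : F[X]) = 1 := by rw [← C_mul, inv_mul_cancel₀ hlam, C_1]
    have hinv' : (C lam * C lam⁻¹ : F[X]) = 1 := by rw [mul_comm, hinv]
    refine QGHA.nonempty_algEquiv (p := C lam⁻¹ * X) (r := C lam * X) (s := 1) ?_ ?_
      one_ne_zero ?_ ?_
    · simp [← mul_assoc, hinv]
    · simp [← mul_assoc, hinv']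
    · simp [← mul_assoc, hinv]
    · simp
  | typeIII f g lam mu hlam hmu =>
    have h0 := mul_ne_zero hlam hmu
    exact QGHA.nonempty_algEquiv (p := X) (r := X) (s := (lam * mu)⁻¹) (by simp) (by simp)
      (inv_ne_zero h0) (by simp) (by rw [comp_X]; exact inv_smul_smul₀ h0 g)

theorem QGHAStep.reflTransGen_of_affine {F : Type*} [Field F] {f g f' g' : F[X]} {a b s : F}
    (ha : a ≠ 0) (hs : s ≠ 0) (hf : (C a * X + C b).comp f' = f.comp (C a * X + C b))
    (hg : s • g' = g.comp (C a * X + C b)) :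
    Relation.ReflTransGen (QGHAStep F) (f, g) (f', g') := by
  have hinv : (C a⁻¹ * C a : F[X]) = 1 := by rw [← C_mul, inv_mul_cancel₀ ha, C_1]
  have hlin : (C a * X : F[X]).comp (X - C (-(a⁻¹ * b))) = C a * X + C b := by
    have : (C a * C a⁻¹ : F[X]) = 1 := by rw [mul_comm, hinv]
    simp only [mul_comp, C_comp, X_comp, C_neg, C_mul, sub_neg_eq_add]
    linear_combination C b * this
  have h₁ := QGHAStep.typeII f g a⁻¹ (inv_ne_zero ha)
  have h₂ := QGHAStep.typeI (C a⁻¹ * f.comp (C a⁻¹⁻¹ * X)) (g.comp (C a⁻¹⁻¹ * X)) (-(a⁻¹ * b))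
  have h₃ := QGHAStep.typeIII f' (s • g') s⁻¹ 1 (inv_ne_zero hs) one_ne_zero
  rw [mul_one, inv_smul_smul₀ hs] at h₃
  rw [inv_inv] at h₁ h₂
  have hf' : (C a⁻¹ * f.comp (C a * X)).comp (X - C (-(a⁻¹ * b))) + C (-(a⁻¹ * b)) = f' := by
    rw [mul_comp, C_comp, comp_assoc, hlin, ← hf]
    simp only [add_comp, mul_comp, C_comp, X_comp, C_neg, C_mul]
    linear_combination f' * hinv
  rw [hf', comp_assoc, hlin, ← hg] at h₂
  exact ((Relation.ReflTransGen.single h₁).tail h₂).tail h₃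

theorem degree_eq_of_natDegree_eq {F : Type*} [Semiring F] {p r : F[X]} (h0 : p = 0 ↔ r = 0)
    (hdeg : p.natDegree = r.natDegree) : p.degree = r.degree := by
  by_cases hp : p = 0
  · rw [hp, h0.1 hp]
  · rw [degree_eq_natDegree hp, degree_eq_natDegree (h0.not.1 hp), hdeg]

theorem degree_comp_affine {F : Type*} [Field F] (p : F[X]) {a : F} (ha : a ≠ 0) (b : F) :
    (p.comp (C a * X + C b)).degree = p.degree := by
  have hlin : (C a * X + C b).natDegree = 1 := natDegree_linear ha
  refine degree_eq_of_natDegree_eq ?_ (by rw [natDegree_comp, hlin, mul_one])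
  rw [comp_eq_zero_iff, or_iff_left]
  rintro ⟨-, hC⟩
  rw [hC, natDegree_C] at hlin
  exact zero_ne_one hlin
/-- For `q ≠ 0` and `deg f > 1`: `H_q(f,g) ≅ H_{q'}(f',g')` as
`F`-algebras if and only if `q = q'` and `(f',g')` is obtained from `(f,g)` by a finite
composition of transformations of types I, II, III.  In particular an isomorphism forces
`q = q'`, `deg f = deg f'` and `deg g = deg g'`. -/
theorem qgha_iso_classification {F : Type*} [Field F] (q q' : F) (f g f' g' : F[X])
    (hq : q ≠ 0) (hf : 1 < f.degree) :
    (Nonempty (QGHA F q f g ≃ₐ[F] QGHA F q' f' g') ↔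
      (q = q' ∧ Relation.ReflTransGen (QGHAStep F) (f, g) (f', g'))) ∧
    (Nonempty (QGHA F q f g ≃ₐ[F] QGHA F q' f' g') →
      q = q' ∧ f.degree = f'.degree ∧ g.degree = g'.degree) := by
  have hf1 : 1 < f.natDegree := by
    rwa [← Nat.cast_lt (α := WithBot ℕ), ← degree_eq_natDegree (by rintro rfl; simp at hf)]
  refine ⟨⟨?_, ?_⟩, ?_⟩
  · rintro ⟨φ⟩
    obtain ⟨hqq, a, b, s, ha, hs, hfp, hgp⟩ := QGHA.exists_affine_of_algEquiv φ hq hf1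
    exact ⟨hqq, QGHAStep.reflTransGen_of_affine ha hs hfp hgp⟩
  · rintro ⟨rfl, hstep⟩
    refine Relation.ReflTransGen.head_induction_on (motive := fun P _ =>
      Nonempty (QGHA F q P.1 P.2 ≃ₐ[F] QGHA F q f' g')) hstep ⟨AlgEquiv.refl⟩ ?_
    rintro P P' hP - ⟨ψ⟩
    obtain ⟨φ⟩ := hP.nonempty_algEquiv q
    exact ⟨φ.trans ψ⟩
  · rintro ⟨φ⟩
    obtain ⟨hqq, a, b, s, ha, hs, hfp, hgp⟩ := QGHA.exists_affine_of_algEquiv φ hq hf1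
    refine ⟨hqq, ?_, ?_⟩
    · have hdeg := congrArg natDegree hfp
      rw [natDegree_comp, natDegree_comp, natDegree_linear ha, one_mul, mul_one] at hdeg
      refine degree_eq_of_natDegree_eq (iff_of_false ?_ ?_) hdeg.symm
      · rintro rfl
        simp at hf1
      · rintro rfl
        simp [← hdeg] at hf1
    · rw [← degree_comp_affine g ha b, ← hgp,
        degree_smul_of_smul_regular _ (IsSMulRegular.of_ne_zero hs)]
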